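/- arXiv:1403.1395 — 3 statements merged into one kernel-verified Lean document; each statement's English description precedes it below -/
import Mathlib

section
/- Fix γ > 0, μ_1, μ_2 ∈ ℝ, and σ_1, σ_2 > 0. Then the density power divergence between the N(μ_1,σ_1²) and N(μ_2,σ_2²) densities satisfies d_γ(f_{μ_1,σ_1}, f_{μ_2,σ_2}) = [σ_2^γ √(1+γ) (2π)^{γ/2}]^{−1} + [γ σ_1^γ √(1+γ) (2π)^{γ/2}]^{−1} − [(γ+1)/(γ σ_2^{γ−1}(γσ_1² + σ_2²)^{1/2}(2π)^{γ/2})] · exp{ (1/2)[ −( μ_2²/(σ_2/√γ)² + μ_1²/σ_1² ) + (σ_1² μ_2 + μ_1 (σ_2/√γ)²)² / ( (σ_1² + (σ_2/√γ)²)(σ_2/√γ)² σ_1² ) ] }. -/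
open Real MeasureTheory

noncomputable section

/-- The `N(μ,σ²)` density. -/
def normalPDF (μ σ x : ℝ) : ℝ :=
  (Real.sqrt (2 * π * σ ^ 2))⁻¹ * Real.exp (-(x - μ) ^ 2 / (2 * σ ^ 2))

/-- The density power divergence of order `γ > 0` between densities `g` and `f` on `ℝ`. -/
def dpd (γ : ℝ) (g f : ℝ → ℝ) : ℝ :=
  ∫ t : ℝ, (f t ^ (1 + γ) - (1 + 1 / γ) * f t ^ γ * g t + (1 / γ) * g t ^ (1 + γ))

theorem aux_int (b m : ℝ) (hb : 0 < b) :
    Integrable (fun t : ℝ => Real.exp (-b * (t - m) ^ 2)) ∧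
      ∫ t : ℝ, Real.exp (-b * (t - m) ^ 2) = √(π / b) := by
  refine ⟨(integrable_exp_neg_mul_sq hb).comp_sub_right m, ?_⟩
  rw [integral_sub_right_eq_self (fun t : ℝ => Real.exp (-b * t ^ 2)) m]
  exact integral_gaussian b

theorem aux_sqrt (σ : ℝ) (h : 0 < σ) : √(2 * π * σ ^ 2) = √(2 * π) * σ := by
  rw [Real.sqrt_mul (by positivity), Real.sqrt_sq h.le]

theorem aux_pow (γ μ σ t : ℝ) (h : 0 < σ) :
    normalPDF μ σ t ^ γ =
      (σ ^ γ * (2 * π) ^ (γ / 2))⁻¹ * Real.exp (-(γ * (t - μ) ^ 2) / (2 * σ ^ 2)) := by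
  unfold normalPDF
  rw [aux_sqrt σ h, Real.mul_rpow (by positivity) (by positivity), Real.inv_rpow (by positivity),
    Real.mul_rpow (by positivity) h.le, ← Real.exp_mul, Real.sqrt_eq_rpow,
    ← Real.rpow_mul (by positivity)]
  congr 2
  · rw [mul_comm, one_div, inv_mul_eq_div]
  · ring

theorem aux_pos (μ σ t : ℝ) (h : 0 < σ) : 0 < normalPDF μ σ t := by
  unfold normalPDF; positivity

theorem aux_main (γ : ℝ) (hγ : 0 < γ) (μ₁ μ₂ σ₁ σ₂ : ℝ) (hσ₁ : 0 < σ₁) (hσ₂ : 0 < σ₂) :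
    Integrable (fun t : ℝ => normalPDF μ₂ σ₂ t ^ γ * normalPDF μ₁ σ₁ t) ∧
    ∫ t : ℝ, normalPDF μ₂ σ₂ t ^ γ * normalPDF μ₁ σ₁ t =
      (σ₂ ^ (γ - 1) * √(γ * σ₁ ^ 2 + σ₂ ^ 2) * (2 * π) ^ (γ / 2))⁻¹ *
        Real.exp (-(γ * (μ₁ - μ₂) ^ 2) / (2 * (γ * σ₁ ^ 2 + σ₂ ^ 2))) := by
  have hD : 0 < γ * σ₁ ^ 2 + σ₂ ^ 2 := by positivity
  set D := γ * σ₁ ^ 2 + σ₂ ^ 2 with hDd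
  have hb : 0 < D / (2 * σ₁ ^ 2 * σ₂ ^ 2) := by positivity
  obtain ⟨hi, hv⟩ := aux_int (D / (2 * σ₁ ^ 2 * σ₂ ^ 2))
    ((γ * σ₁ ^ 2 * μ₂ + σ₂ ^ 2 * μ₁) / D) hb
  have hfun : (fun t : ℝ => normalPDF μ₂ σ₂ t ^ γ * normalPDF μ₁ σ₁ t) = fun t =>
      ((σ₂ ^ γ * (2 * π) ^ (γ / 2))⁻¹ * (√(2 * π) * σ₁)⁻¹ *
        Real.exp (-(γ * (μ₁ - μ₂) ^ 2) / (2 * D))) *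
      Real.exp (-(D / (2 * σ₁ ^ 2 * σ₂ ^ 2)) *
        (t - (γ * σ₁ ^ 2 * μ₂ + σ₂ ^ 2 * μ₁) / D) ^ 2) := by
    funext t
    rw [aux_pow γ μ₂ σ₂ t hσ₂]
    unfold normalPDF
    rw [aux_sqrt σ₁ hσ₁, mul_assoc (_ * _) (Real.exp _) (Real.exp _), ← Real.exp_add,
      mul_mul_mul_comm, ← Real.exp_add]
    congr 2
    have := hD.ne'
    field_simp
    rw [hDd]
    ring
  rw [hfun]
  refine ⟨hi.const_mul _, ?_⟩
  rw [integral_const_mul, hv]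
  have h1 : √(π / (D / (2 * σ₁ ^ 2 * σ₂ ^ 2))) = √(2 * π) * σ₁ * σ₂ / √D := by
    rw [show π / (D / (2 * σ₁ ^ 2 * σ₂ ^ 2)) = (2 * π) * (σ₁ * σ₂) ^ 2 / D by field_simp,
      Real.sqrt_div (by positivity), Real.sqrt_mul (by positivity), Real.sqrt_sq (by positivity)]
    ring
  rw [h1, Real.rpow_sub_one hσ₂.ne']
  have h2 : 0 < √D := by positivity
  have h3 : 0 < √(2 * π) := by positivity
  have h4 : 0 < σ₂ ^ γ := by positivity
  have h5 : 0 < (2 * π) ^ (γ / 2) := by positivity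
  generalize √(2 * π) = q at *
  generalize (2 * π) ^ (γ / 2) = r at *
  generalize σ₂ ^ γ = s at *
  generalize √D = u at *
  field_simp

theorem aux_self (γ : ℝ) (hγ : 0 < γ) (μ σ : ℝ) (hσ : 0 < σ) :
    Integrable (fun t : ℝ => normalPDF μ σ t ^ (1 + γ)) ∧
    ∫ t : ℝ, normalPDF μ σ t ^ (1 + γ) =
      (σ ^ γ * √(1 + γ) * (2 * π) ^ (γ / 2))⁻¹ := by
  have hfun : (fun t : ℝ => normalPDF μ σ t ^ (1 + γ)) =
      fun t => normalPDF μ σ t ^ γ * normalPDF μ σ t := by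
    funext t
    rw [add_comm, Real.rpow_add_one (aux_pos μ σ t hσ).ne']
  obtain ⟨hi, hv⟩ := aux_main γ hγ μ μ σ σ hσ hσ
  rw [hfun]
  refine ⟨hi, ?_⟩
  rw [hv, show γ * σ ^ 2 + σ ^ 2 = (1 + γ) * σ ^ 2 by ring, Real.sqrt_mul (by positivity),
    Real.sqrt_sq hσ.le, Real.rpow_sub_one hσ.ne']
  simp only [sub_self, ne_eq, OfNat.ofNat_ne_zero, not_false_eq_true, zero_pow, mul_zero, neg_zero,
    zero_div, Real.exp_zero, mul_one]
  congr 2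
  field_simp

/-- **Closed form of the density power divergence between two normal densities** (general
means and variances). -/
theorem dpd_between_normals_closed_form
    (γ : ℝ) (hγ : 0 < γ) (μ₁ μ₂ σ₁ σ₂ : ℝ) (hσ₁ : 0 < σ₁) (hσ₂ : 0 < σ₂) :
    dpd γ (normalPDF μ₁ σ₁) (normalPDF μ₂ σ₂) =
      (σ₂ ^ γ * Real.sqrt (1 + γ) * (2 * π) ^ (γ / 2))⁻¹ +
        (γ * σ₁ ^ γ * Real.sqrt (1 + γ) * (2 * π) ^ (γ / 2))⁻¹ -
        ((γ + 1) / (γ * σ₂ ^ (γ - 1) * (γ * σ₁ ^ 2 + σ₂ ^ 2) ^ ((1 : ℝ) / 2) *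
            (2 * π) ^ (γ / 2))) *
          Real.exp ((1 / 2) *
            (-(μ₂ ^ 2 / (σ₂ / Real.sqrt γ) ^ 2 + μ₁ ^ 2 / σ₁ ^ 2) +
              (σ₁ ^ 2 * μ₂ + μ₁ * (σ₂ / Real.sqrt γ) ^ 2) ^ 2 /
                ((σ₁ ^ 2 + (σ₂ / Real.sqrt γ) ^ 2) * (σ₂ / Real.sqrt γ) ^ 2 * σ₁ ^ 2))) := by
  obtain ⟨i1, v1⟩ := aux_self γ hγ μ₂ σ₂ hσ₂
  obtain ⟨i2, v2⟩ := aux_self γ hγ μ₁ σ₁ hσ₁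
  obtain ⟨i3, v3⟩ := aux_main γ hγ μ₁ μ₂ σ₁ σ₂ hσ₁ hσ₂
  unfold dpd
  simp only [mul_assoc (1 + 1 / γ)]
  have i4 : Integrable (fun t : ℝ => normalPDF μ₂ σ₂ t ^ (1 + γ) -
      (1 + 1 / γ) * (normalPDF μ₂ σ₂ t ^ γ * normalPDF μ₁ σ₁ t)) := i1.sub (i3.const_mul _)
  rw [integral_add i4 (i2.const_mul _),
    integral_sub i1 (i3.const_mul _), integral_const_mul, integral_const_mul, v1, v2, v3]
  have hs : (σ₂ / √γ) ^ 2 = σ₂ ^ 2 / γ := by rw [div_pow, Real.sq_sqrt hγ.le]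
  have hD : 0 < γ * σ₁ ^ 2 + σ₂ ^ 2 := by positivity
  have hE : (1 / 2) * (-(μ₂ ^ 2 / (σ₂ / √γ) ^ 2 + μ₁ ^ 2 / σ₁ ^ 2) +
              (σ₁ ^ 2 * μ₂ + μ₁ * (σ₂ / √γ) ^ 2) ^ 2 /
                ((σ₁ ^ 2 + (σ₂ / √γ) ^ 2) * (σ₂ / √γ) ^ 2 * σ₁ ^ 2)) =
      -(γ * (μ₁ - μ₂) ^ 2) / (2 * (γ * σ₁ ^ 2 + σ₂ ^ 2)) := by
    rw [hs, show σ₁ ^ 2 + σ₂ ^ 2 / γ = (γ * σ₁ ^ 2 + σ₂ ^ 2) / γ by field_simp]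
    have := hD.ne'
    field_simp
    ring
  rw [hE, ← Real.sqrt_eq_rpow]
  have h1 : 0 < √(γ * σ₁ ^ 2 + σ₂ ^ 2) := by positivity
  have h2 : 0 < σ₂ ^ (γ - 1) := by positivity
  have h3 : 0 < (2 * π) ^ (γ / 2) := by positivity
  have e1 : (γ * σ₁ ^ γ * √(1 + γ) * (2 * π) ^ (γ / 2))⁻¹ =
      1 / γ * (σ₁ ^ γ * √(1 + γ) * (2 * π) ^ (γ / 2))⁻¹ := by
    rw [one_div, ← mul_inv]; congr 1; ring
  have e2 : (γ + 1) / (γ * σ₂ ^ (γ - 1) * √(γ * σ₁ ^ 2 + σ₂ ^ 2) * (2 * π) ^ (γ / 2)) =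
      (1 + 1 / γ) * (σ₂ ^ (γ - 1) * √(γ * σ₁ ^ 2 + σ₂ ^ 2) * (2 * π) ^ (γ / 2))⁻¹ := by
    generalize √(γ * σ₁ ^ 2 + σ₂ ^ 2) = u at *
    generalize σ₂ ^ (γ - 1) = v at *
    generalize (2 * π) ^ (γ / 2) = w at *
    field_simp
  rw [e1, e2]
  ring

end
end

section
/- Fix β > 0, μ_0 ∈ ℝ, σ_0 > 0, and let X ~ N(μ_0, σ_0²). Define ψ_β(x; μ, σ) = σ^{−β}(2π)^{−β/2}[(1+β)^{−3/2} − β^{−1} exp(−β(x−μ)²/(2σ²))] for μ ∈ ℝ, σ > 0, and let u_β(x) = ∇_{(μ,σ)} ψ_β(x; μ, σ) evaluated at (μ_0, σ_0). Then E[u_β(X)] = 0 and the covariance matrix of u_β(X) equals K_β(σ_0) = [σ_0^{2+2β}(2π)^β]^{−1}·[ (1+2β)^{−3/2}·diag(1, (4β²+2)/(1+2β)) − diag(0, β²/(1+β)³) ]. -/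
open Real MeasureTheory ProbabilityTheory Matrix

noncomputable section

/-- The single-observation DPD objective
`ψ_β(x; μ, σ) = σ^{-β}(2π)^{-β/2}[(1+β)^{-3/2} - β^{-1} exp(-β(x-μ)²/(2σ²))]`. -/
def psiDPD (β x μ σ : ℝ) : ℝ :=
  σ ^ (-β) * (2 * π) ^ (-β / 2) *
    ((1 + β) ^ (-(3 : ℝ) / 2) - β⁻¹ * Real.exp (-(β * (x - μ) ^ 2 / (2 * σ ^ 2))))

/-- The single-observation score vector `u_β(x)`: the gradient of `ψ_β(x; ·, ·)` at the true
parameter `(μ₀, σ₀)`. -/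
def scoreDPD (β μ₀ σ₀ x : ℝ) : Fin 2 → ℝ :=
  ![deriv (fun m => psiDPD β x m σ₀) μ₀, deriv (fun s => psiDPD β x μ₀ s) σ₀]

lemma aux_int_s17 (c : ℝ) (hc : 0 < c) (k : ℕ) :
    Integrable (fun x : ℝ => x ^ k * Real.exp (-c * x ^ 2)) := by
  have h := integrable_rpow_mul_exp_neg_mul_sq hc (s := (k : ℝ))
    (by have : (0 : ℝ) ≤ k := Nat.cast_nonneg k
        linarith)
  simpa [Real.rpow_natCast] using h

lemma aux_J1 (c : ℝ) (hc : 0 < c) : ∫ x : ℝ, x ^ 1 * Real.exp (-c * x ^ 2) = 0 := by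
  have hd : ∀ x : ℝ, HasDerivAt (fun x : ℝ => Real.exp (-c * x ^ 2))
      ((-2 * c) * (x ^ 1 * Real.exp (-c * x ^ 2))) x := by
    intro x
    have := ((hasDerivAt_pow 2 x).const_mul (-c)).exp
    refine this.congr_deriv ?_
    push_cast
    ring
  have h := integral_eq_zero_of_hasDerivAt_of_integrable hd ((aux_int_s17 c hc 1).const_mul _)
    (by simpa using aux_int_s17 c hc 0)
  rw [integral_const_mul] at h
  rcases mul_eq_zero.1 h with h | h
  · linarith
  · exact h

lemma aux_J (c : ℝ) (hc : 0 < c) (k : ℕ) :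
    ∫ x : ℝ, x ^ (k + 2) * Real.exp (-c * x ^ 2)
      = (k + 1) / (2 * c) * ∫ x : ℝ, x ^ k * Real.exp (-c * x ^ 2) := by
  have hd : ∀ x : ℝ, HasDerivAt (fun x : ℝ => x ^ (k + 1) * Real.exp (-c * x ^ 2))
      ((k + 1) * (x ^ k * Real.exp (-c * x ^ 2)) -
        (2 * c) * (x ^ (k + 2) * Real.exp (-c * x ^ 2))) x := by
    intro x
    have := (hasDerivAt_pow (k + 1) x).mul ((hasDerivAt_pow 2 x).const_mul (-c)).exp
    refine this.congr_deriv ?_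
    push_cast
    ring
  have i1 := (aux_int_s17 c hc k).const_mul ((k : ℝ) + 1)
  have i2 := (aux_int_s17 c hc (k + 2)).const_mul (2 * c)
  have h := integral_eq_zero_of_hasDerivAt_of_integrable hd (i1.sub i2) (aux_int_s17 c hc (k + 1))
  rw [integral_sub i1 i2, integral_const_mul, integral_const_mul] at h
  rw [div_mul_eq_mul_div, eq_div_iff (by positivity)]
  linarith

def GG (b : ℝ) (k : ℕ) : ℝ :=
  ∫ z, z ^ k * Real.exp (-(b * z ^ 2 / 2)) ∂(gaussianReal 0 1)

lemma aux_pdf (b : ℝ) (k : ℕ) (x : ℝ) :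
    gaussianPDFReal 0 1 x * (x ^ k * Real.exp (-(b * x ^ 2 / 2)))
      = (√(2 * π))⁻¹ * (x ^ k * Real.exp (-((1 + b) / 2) * x ^ 2)) := by
  have : Real.exp (-((1 + b) / 2) * x ^ 2)
      = Real.exp (-x ^ 2 / 2) * Real.exp (-(b * x ^ 2 / 2)) := by
    rw [← Real.exp_add]; congr 1; ring
  rw [this, gaussianPDFReal]
  simp; ring

lemma GG_eq (b : ℝ) (k : ℕ) :
    GG b k = (√(2 * π))⁻¹ * ∫ x : ℝ, x ^ k * Real.exp (-((1 + b) / 2) * x ^ 2) := by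
  rw [GG, integral_gaussianReal_eq_integral_smul one_ne_zero, ← integral_const_mul]
  simp only [smul_eq_mul, aux_pdf]

lemma GG_int (b : ℝ) (hb : 0 ≤ b) (k : ℕ) :
    Integrable (fun z => z ^ k * Real.exp (-(b * z ^ 2 / 2))) (gaussianReal 0 1) := by
  rw [gaussianReal_of_var_ne_zero _ one_ne_zero,
    integrable_withDensity_iff_integrable_smul' (measurable_gaussianPDF 0 1)
      (Filter.Eventually.of_forall fun x => gaussianPDF_lt_top)]
  simp only [toReal_gaussianPDF, smul_eq_mul, aux_pdf]
  exact (aux_int_s17 _ (by positivity) k).const_mul _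

lemma GG_0 (b : ℝ) (hb : 0 ≤ b) : GG b 0 = (1 + b) ^ (-(1 : ℝ) / 2) := by
  have h : (0 : ℝ) < 1 + b := by positivity
  have := integral_gaussian ((1 + b) / 2)
  rw [GG_eq]
  simp only [pow_zero, one_mul, this]
  rw [← Real.sqrt_inv, ← Real.sqrt_mul (by positivity), Real.sqrt_eq_rpow,
    show (2 * π)⁻¹ * (π / ((1 + b) / 2)) = (1 + b)⁻¹ by field_simp,
    Real.inv_rpow h.le, ← Real.rpow_neg h.le]
  norm_num

lemma GG_1 (b : ℝ) (hb : 0 ≤ b) : GG b 1 = 0 := by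
  rw [GG_eq, aux_J1 _ (by positivity), mul_zero]

lemma GG_s (b : ℝ) (hb : 0 ≤ b) (k : ℕ) : GG b (k + 2) = (k + 1) / (1 + b) * GG b k := by
  rw [GG_eq, GG_eq, aux_J _ (by positivity)]
  field_simp

lemma score0 (β μ₀ σ₀ z : ℝ) (hβ : 0 < β) (hσ₀ : 0 < σ₀) :
    scoreDPD β μ₀ σ₀ (σ₀ * z + μ₀) 0
      = (σ₀ ^ (-β - 1) * (2 * π) ^ (-β / 2)) * (-(z ^ 1 * Real.exp (-(β * z ^ 2 / 2)))) := by
  have hd : HasDerivAt (fun m => psiDPD β (σ₀ * z + μ₀) m σ₀) _ μ₀ :=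
    (((((((hasDerivAt_id μ₀).const_sub (σ₀ * z + μ₀)).pow 2).const_mul β).div_const
      (2 * σ₀ ^ 2)).neg.exp.const_mul β⁻¹).const_sub ((1 + β) ^ (-(3 : ℝ) / 2))).const_mul
      (σ₀ ^ (-β) * (2 * π) ^ (-β / 2))
  have : scoreDPD β μ₀ σ₀ (σ₀ * z + μ₀) 0 = _ := hd.deriv
  rw [this, Real.rpow_sub_one hσ₀.ne']
  simp
  field_simp

lemma score1 (β μ₀ σ₀ z : ℝ) (hβ : 0 < β) (hσ₀ : 0 < σ₀) :
    scoreDPD β μ₀ σ₀ (σ₀ * z + μ₀) 1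
      = (σ₀ ^ (-β - 1) * (2 * π) ^ (-β / 2)) *
        (-(β * (1 + β) ^ (-(3 : ℝ) / 2)) + (z ^ 0 * Real.exp (-(β * z ^ 2 / 2))
          - z ^ 2 * Real.exp (-(β * z ^ 2 / 2)))) := by
  have h1 : HasDerivAt (fun s : ℝ => β * (σ₀ * z + μ₀ - μ₀) ^ 2 / (2 * s ^ 2)) _ σ₀ :=
    (hasDerivAt_const σ₀ (β * (σ₀ * z + μ₀ - μ₀) ^ 2)).div
      (((hasDerivAt_id σ₀).pow 2).const_mul 2) (by simp; positivity)
  have hd : HasDerivAt (fun s => psiDPD β (σ₀ * z + μ₀) μ₀ s) _ σ₀ :=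
    ((Real.hasDerivAt_rpow_const (p := -β) (Or.inl hσ₀.ne')).mul_const ((2 * π) ^ (-β / 2))).mul
      ((h1.neg.exp.const_mul β⁻¹).const_sub ((1 + β) ^ (-(3 : ℝ) / 2)))
  have : scoreDPD β μ₀ σ₀ (σ₀ * z + μ₀) 1 = _ := hd.deriv
  rw [this, Real.rpow_sub_one hσ₀.ne']
  have e : (β * (σ₀ * z + μ₀ - μ₀) ^ 2 / (2 * σ₀ ^ 2)) = β * z ^ 2 / 2 := by
    field_simp; ring
  simp [e]
  field_simp
  ring

lemma gauss_change (μ₀ σ₀ : ℝ) (hσ₀ : 0 < σ₀) (f : ℝ → ℝ) :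
    ∫ x, f x ∂(gaussianReal μ₀ (Real.toNNReal (σ₀ ^ 2)))
      = ∫ z, f (σ₀ * z + μ₀) ∂(gaussianReal 0 1) := by
  have h : (gaussianReal 0 1).map (fun z => σ₀ * z + μ₀)
      = gaussianReal μ₀ (Real.toNNReal (σ₀ ^ 2)) := by
    have := gaussianReal_map_add_const (μ := σ₀ * 0) (v := NNReal.mk (σ₀ ^ 2) (sq_nonneg σ₀) * 1) μ₀
    rw [← gaussianReal_map_const_mul, Measure.map_map (by fun_prop) (by fun_prop)] at this
    rw [show (fun z => σ₀ * z + μ₀) = (fun x => x + μ₀) ∘ (fun x => σ₀ * x) from rfl, this]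
    congr 1
    · simp
    · ext; simp [Real.coe_toNNReal _ (sq_nonneg σ₀)]
  rw [← h]
  have : MeasurableEmbedding (fun z : ℝ => σ₀ * z + μ₀) :=
    (measurableEmbedding_addRight μ₀).comp (measurableEmbedding_mulLeft₀ hσ₀.ne')
  exact this.integral_map f

lemma D_sq (β σ₀ : ℝ) (hσ₀ : 0 < σ₀) :
    (σ₀ ^ (-β - 1) * (2 * π) ^ (-β / 2)) * (σ₀ ^ (-β - 1) * (2 * π) ^ (-β / 2))
      = (σ₀ ^ (2 + 2 * β) * (2 * π) ^ β)⁻¹ := by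
  have hp : (0 : ℝ) < 2 * π := by positivity
  rw [mul_mul_mul_comm, ← Real.rpow_add hσ₀, ← Real.rpow_add hp, mul_inv, ← Real.rpow_neg hσ₀.le,
    ← Real.rpow_neg hp.le]
  congr 2 <;> ring

lemma exp_dbl (β z : ℝ) : Real.exp (-(2 * β * z ^ 2 / 2))
    = Real.exp (-(β * z ^ 2 / 2)) * Real.exp (-(β * z ^ 2 / 2)) := by
  rw [← Real.exp_add]; congr 1; ring

lemma rpow_half (γ : ℝ) (h : 0 < γ) : γ ^ (-(1 : ℝ) / 2) = γ * γ ^ (-(3 : ℝ) / 2) := by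
  rw [mul_comm, ← Real.rpow_add_one h.ne']; norm_num

lemma mean0 (β μ₀ σ₀ : ℝ) (hβ : 0 < β) (hσ₀ : 0 < σ₀) :
    ∫ x, scoreDPD β μ₀ σ₀ x 0 ∂(gaussianReal μ₀ (Real.toNNReal (σ₀ ^ 2))) = 0 := by
  rw [gauss_change _ _ hσ₀]
  simp only [score0 _ _ _ _ hβ hσ₀]
  rw [integral_const_mul, integral_neg]
  have := GG_1 β hβ.le
  rw [GG] at this
  rw [this]; simp

lemma GG_diff (β : ℝ) (hβ : 0 < β) : GG β 0 - GG β 2 = β * (1 + β) ^ (-(3 : ℝ) / 2) := by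
  have h1 := GG_s β hβ.le 0
  have h : 0 < 1 + β := by positivity
  simp only [zero_add] at h1
  rw [h1, GG_0 β hβ.le, rpow_half _ h]
  field_simp
  push_cast; ring

lemma mean1 (β μ₀ σ₀ : ℝ) (hβ : 0 < β) (hσ₀ : 0 < σ₀) :
    ∫ x, scoreDPD β μ₀ σ₀ x 1 ∂(gaussianReal μ₀ (Real.toNNReal (σ₀ ^ 2))) = 0 := by
  rw [gauss_change _ _ hσ₀]
  simp only [score1 _ _ _ _ hβ hσ₀]
  rw [integral_const_mul, integral_add (integrable_const _)
    ((GG_int β hβ.le 0).sub' (GG_int β hβ.le 2)),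
    integral_sub (GG_int β hβ.le 0) (GG_int β hβ.le 2)]
  have := GG_diff β hβ
  rw [GG, GG] at this
  rw [this]; simp

lemma cov00 (β μ₀ σ₀ : ℝ) (hβ : 0 < β) (hσ₀ : 0 < σ₀) :
    ∫ x, scoreDPD β μ₀ σ₀ x 0 * scoreDPD β μ₀ σ₀ x 0
      ∂(gaussianReal μ₀ (Real.toNNReal (σ₀ ^ 2)))
      = (σ₀ ^ (2 + 2 * β) * (2 * π) ^ β)⁻¹ * (1 + 2 * β) ^ (-(3 : ℝ) / 2) := by
  rw [gauss_change _ _ hσ₀ (fun x => scoreDPD β μ₀ σ₀ x 0 * scoreDPD β μ₀ σ₀ x 0)]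
  simp only [score0 _ _ _ _ hβ hσ₀]
  have e : ∀ z : ℝ, σ₀ ^ (-β - 1) * (2 * π) ^ (-β / 2) * -(z ^ 1 * Real.exp (-(β * z ^ 2 / 2))) *
      (σ₀ ^ (-β - 1) * (2 * π) ^ (-β / 2) * -(z ^ 1 * Real.exp (-(β * z ^ 2 / 2))))
      = (σ₀ ^ (2 + 2 * β) * (2 * π) ^ β)⁻¹ * (z ^ 2 * Real.exp (-(2 * β * z ^ 2 / 2))) := by
    intro z; rw [← D_sq _ _ hσ₀, exp_dbl]; ring
  simp only [e]
  rw [integral_const_mul]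
  have h1 := GG_s (2 * β) (by positivity) 0
  have h : 0 < 1 + 2 * β := by positivity
  rw [GG_0 _ (by positivity), rpow_half _ h, GG] at h1
  simp only [zero_add] at h1
  rw [h1]
  field_simp
  simp

lemma cov01 (β μ₀ σ₀ : ℝ) (hβ : 0 < β) (hσ₀ : 0 < σ₀) :
    ∫ x, scoreDPD β μ₀ σ₀ x 0 * scoreDPD β μ₀ σ₀ x 1
      ∂(gaussianReal μ₀ (Real.toNNReal (σ₀ ^ 2))) = 0 := by
  rw [gauss_change _ _ hσ₀ (fun x => scoreDPD β μ₀ σ₀ x 0 * scoreDPD β μ₀ σ₀ x 1)]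
  simp only [score0 _ _ _ _ hβ hσ₀, score1 _ _ _ _ hβ hσ₀]
  generalize (1 + β) ^ (-(3 : ℝ) / 2) = a
  generalize σ₀ ^ (-β - 1) * (2 * π) ^ (-β / 2) = D
  have e : ∀ z : ℝ, D * -(z ^ 1 * Real.exp (-(β * z ^ 2 / 2))) *
      (D * (-(β * a) + (z ^ 0 * Real.exp (-(β * z ^ 2 / 2))
          - z ^ 2 * Real.exp (-(β * z ^ 2 / 2)))))
      = (D ^ 2 * β * a) * (z ^ 1 * Real.exp (-(β * z ^ 2 / 2)))
        + (D ^ 2 * (z ^ (1 + 2) * Real.exp (-(2 * β * z ^ 2 / 2)))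
          - D ^ 2 * (z ^ 1 * Real.exp (-(2 * β * z ^ 2 / 2)))) := by
    intro z; rw [exp_dbl]; ring
  simp only [e]
  have hb : 0 ≤ 2 * β := by positivity
  have i1 := (GG_int β hβ.le 1).const_mul (D ^ 2 * β * a)
  have i2 := (GG_int _ hb (1 + 2)).const_mul (D ^ 2)
  have i3 := (GG_int _ hb 1).const_mul (D ^ 2)
  rw [integral_add i1 (i2.sub' i3), integral_sub i2 i3, integral_const_mul, integral_const_mul,
    integral_const_mul]
  change D ^ 2 * β * a * GG β 1 + (D ^ 2 * GG (2 * β) (1 + 2) - D ^ 2 * GG (2 * β) 1) = 0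
  rw [GG_s _ hb, GG_1 _ hb, GG_1 _ hβ.le]
  simp

lemma cov11 (β μ₀ σ₀ : ℝ) (hβ : 0 < β) (hσ₀ : 0 < σ₀) :
    ∫ x, scoreDPD β μ₀ σ₀ x 1 * scoreDPD β μ₀ σ₀ x 1
      ∂(gaussianReal μ₀ (Real.toNNReal (σ₀ ^ 2)))
      = (σ₀ ^ (2 + 2 * β) * (2 * π) ^ β)⁻¹ *
        ((1 + 2 * β) ^ (-(3 : ℝ) / 2) * ((4 * β ^ 2 + 2) / (1 + 2 * β))
          - β ^ 2 / (1 + β) ^ 3) := by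
  rw [gauss_change _ _ hσ₀ (fun x => scoreDPD β μ₀ σ₀ x 1 * scoreDPD β μ₀ σ₀ x 1)]
  simp only [score1 _ _ _ _ hβ hσ₀]
  have hq : 0 < 1 + β := by positivity
  have ha : (1 + β) ^ (-(3 : ℝ) / 2) * (1 + β) ^ (-(3 : ℝ) / 2) = 1 / (1 + β) ^ 3 := by
    rw [← Real.rpow_add hq, show (-(3 : ℝ) / 2 + -(3 : ℝ) / 2) = -((3 : ℕ) : ℝ) by norm_num,
      Real.rpow_neg hq.le, Real.rpow_natCast, one_div]
  have hdiff := GG_diff β hβ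
  rw [← D_sq _ _ hσ₀]
  generalize (1 + β) ^ (-(3 : ℝ) / 2) = a at *
  generalize σ₀ ^ (-β - 1) * (2 * π) ^ (-β / 2) = D
  have e : ∀ z : ℝ, D * (-(β * a) + (z ^ 0 * Real.exp (-(β * z ^ 2 / 2))
          - z ^ 2 * Real.exp (-(β * z ^ 2 / 2)))) *
      (D * (-(β * a) + (z ^ 0 * Real.exp (-(β * z ^ 2 / 2))
          - z ^ 2 * Real.exp (-(β * z ^ 2 / 2)))))
      = D * D * ((β * a) ^ 2 + ((-2 * β * a) * (z ^ 0 * Real.exp (-(β * z ^ 2 / 2))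
          - z ^ 2 * Real.exp (-(β * z ^ 2 / 2)))
        + ((z ^ 0 * Real.exp (-(2 * β * z ^ 2 / 2))
          - 2 * (z ^ (0 + 2) * Real.exp (-(2 * β * z ^ 2 / 2))))
          + z ^ (0 + 2 + 2) * Real.exp (-(2 * β * z ^ 2 / 2))))) := by
    intro z; rw [exp_dbl]; ring
  simp only [e]
  have hb : 0 ≤ 2 * β := by positivity
  have i0 := GG_int β hβ.le 0
  have i2 := GG_int β hβ.le 2
  have j0 := GG_int _ hb 0
  have j2 := (GG_int _ hb (0 + 2)).const_mul 2
  have j4 := GG_int _ hb (0 + 2 + 2)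
  have k1 := (i0.sub' i2).const_mul (-2 * β * a)
  have k2 := (j0.sub' j2).fun_add j4
  rw [integral_const_mul, integral_add (integrable_const _) (k1.fun_add k2), integral_add k1 k2,
    integral_add (j0.sub' j2) j4, integral_sub j0 j2, integral_const_mul, integral_const_mul,
    integral_sub i0 i2]
  change D * D * (∫ _, (β * a) ^ 2 ∂(gaussianReal 0 1) + (-2 * β * a * (GG β 0 - GG β 2)
    + (GG (2 * β) 0 - 2 * GG (2 * β) (0 + 2) + GG (2 * β) (0 + 2 + 2)))) = _
  have hg : 0 < 1 + 2 * β := by positivity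
  rw [hdiff, GG_s _ hb (0 + 2), GG_s _ hb 0, GG_0 _ hb, rpow_half _ hg]
  have ha' : β ^ 2 / (1 + β) ^ 3 = β ^ 2 * (a * a) := by rw [ha]; ring
  rw [ha']
  simp only [integral_const, probReal_univ, one_smul]
  generalize (1 + 2 * β) ^ (-(3 : ℝ) / 2) = g
  push_cast
  field_simp
  ring

/-- **Mean and covariance of the DPD score under the model.** If `X ~ N(μ₀, σ₀²)` then
`E[u_β(X)] = 0` and `Cov(u_β(X)) = K_β(σ₀)`. -/
theorem dpd_score_mean_zero_and_covariance
    (β : ℝ) (hβ : 0 < β) (μ₀ σ₀ : ℝ) (hσ₀ : 0 < σ₀) :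
    (∀ i : Fin 2,
      (∫ x, scoreDPD β μ₀ σ₀ x i ∂(gaussianReal μ₀ (Real.toNNReal (σ₀ ^ 2)))) = 0) ∧
    (Matrix.of fun i j : Fin 2 =>
        (∫ x, scoreDPD β μ₀ σ₀ x i * scoreDPD β μ₀ σ₀ x j
          ∂(gaussianReal μ₀ (Real.toNNReal (σ₀ ^ 2)))) -
        (∫ x, scoreDPD β μ₀ σ₀ x i ∂(gaussianReal μ₀ (Real.toNNReal (σ₀ ^ 2)))) *
        (∫ x, scoreDPD β μ₀ σ₀ x j ∂(gaussianReal μ₀ (Real.toNNReal (σ₀ ^ 2))))) =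
      (σ₀ ^ (2 + 2 * β) * (2 * π) ^ β)⁻¹ •
        ((1 + 2 * β) ^ (-(3 : ℝ) / 2) •
            Matrix.diagonal ![1, (4 * β ^ 2 + 2) / (1 + 2 * β)] -
          Matrix.diagonal ![0, β ^ 2 / (1 + β) ^ 3]) := by
  have m0 := mean0 β μ₀ σ₀ hβ hσ₀
  have m1 := mean1 β μ₀ σ₀ hβ hσ₀
  have c01 := cov01 β μ₀ σ₀ hβ hσ₀
  have c10 : ∫ x, scoreDPD β μ₀ σ₀ x 1 * scoreDPD β μ₀ σ₀ x 0
      ∂(gaussianReal μ₀ (Real.toNNReal (σ₀ ^ 2))) = 0 := by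
    rw [← c01]; congr 1; ext x; ring
  refine ⟨?_, ?_⟩
  · intro i
    fin_cases i
    · exact m0
    · exact m1
  · ext i j
    fin_cases i <;> fin_cases j
    · simp [m0, cov00 β μ₀ σ₀ hβ hσ₀]
    · simp [m0, c01]
    · simp [m0, c10]
    · simp [m1, cov11 β μ₀ σ₀ hβ hσ₀]

end
end

section
/- Fix β > 0, μ_0 ∈ ℝ, σ_0 > 0, and let X ~ N(μ_0, σ_0²). Define ψ_β(x; μ, σ) = σ^{−β}(2π)^{−β/2}[(1+β)^{−3/2} − β^{−1} exp(−β(x−μ)²/(2σ²))] for μ ∈ ℝ, σ > 0. Then the expected Hessian of ψ_β with respect to (μ, σ) at (μ_0, σ_0) equals J_β(σ_0) = [√(1+β)(2π)^{β/2} σ_0^{2+β}]^{−1} · diag( 1/(1+β), (β²+2)/(1+β)² ); in particular the off-diagonal entries E[∂²ψ_β/∂μ∂σ (X; μ_0, σ_0)] vanish. -/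
open Real MeasureTheory ProbabilityTheory Matrix

noncomputable section

/-- The Hessian of `ψ_β(x; ·, ·)` with respect to `(μ, σ)` at `(μ₀, σ₀)`, as a `2 × 2`
matrix of iterated partial derivatives. -/
def hessPsi (β μ₀ σ₀ x : ℝ) : Matrix (Fin 2) (Fin 2) ℝ :=
  !![deriv (fun m => deriv (fun m' => psiDPD β x m' σ₀) m) μ₀,
       deriv (fun m => deriv (fun s => psiDPD β x m s) σ₀) μ₀;
     deriv (fun s => deriv (fun m => psiDPD β x m s) μ₀) σ₀,
       deriv (fun s => deriv (fun s' => psiDPD β x μ₀ s') s) σ₀]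


lemma hE_mu (β x m s : ℝ) : HasDerivAt (fun m => Real.exp (-(β * (x - m) ^ 2 / (2 * s ^ 2))))
    (Real.exp (-(β * (x - m) ^ 2 / (2 * s ^ 2))) * (β * (x - m) / s ^ 2)) m := by
  have h := (((((hasDerivAt_id m).const_sub x).pow 2).const_mul β).div_const (2 * s ^ 2)).neg.exp
  refine HasDerivAt.congr_deriv h ?_
  simp only [id, Pi.neg_apply, Pi.pow_apply]
  by_cases hs : s = 0
  · subst hs; simp
  · field_simp
    simp
    ring

lemma hE_s (β x m s : ℝ) (hs : 0 < s) :
    HasDerivAt (fun s => Real.exp (-(β * (x - m) ^ 2 / (2 * s ^ 2))))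
    (Real.exp (-(β * (x - m) ^ 2 / (2 * s ^ 2))) * (β * (x - m) ^ 2 / s ^ 3)) s := by
  have h := ((hasDerivAt_const s (β * (x - m) ^ 2)).div
    (((hasDerivAt_id s).pow 2).const_mul 2) (by simp [hs.ne'])).neg.exp
  refine HasDerivAt.congr_deriv h ?_
  simp only [id, Pi.neg_apply, Pi.pow_apply, Pi.div_apply]
  field_simp
  simp

lemma h_rp (β s : ℝ) (hs : 0 < s) : HasDerivAt (fun s : ℝ => s ^ (-β)) (-β * (s ^ (-β) / s)) s := by
  have h := Real.hasDerivAt_rpow_const (x := s) (p := -β) (Or.inl hs.ne')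
  rwa [Real.rpow_sub_one hs.ne'] at h

lemma psi_mu (β : ℝ) (hβ : 0 < β) (x m s : ℝ) : HasDerivAt (fun m => psiDPD β x m s)
    (-(s ^ (-β) * (2 * π) ^ (-β / 2) *
      ((x - m) / s ^ 2 * Real.exp (-(β * (x - m) ^ 2 / (2 * s ^ 2)))))) m := by
  unfold psiDPD
  have h := (((hE_mu β x m s).const_mul β⁻¹).const_sub ((1 + β) ^ (-(3 : ℝ) / 2))).const_mul
    (s ^ (-β) * (2 * π) ^ (-β / 2))
  refine HasDerivAt.congr_deriv h ?_
  have : β⁻¹ * β = 1 := inv_mul_cancel₀ hβ.ne'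
  linear_combination (-(s ^ (-β) * (2 * π) ^ (-β / 2) *
      ((x - m) / s ^ 2 * Real.exp (-(β * (x - m) ^ 2 / (2 * s ^ 2)))))) * this

lemma psi_s (β : ℝ) (hβ : 0 < β) (x m s : ℝ) (hs : 0 < s) : HasDerivAt (fun s => psiDPD β x m s)
    ((2 * π) ^ (-β / 2) * (s ^ (-β) * (-(β * (1 + β) ^ (-(3 : ℝ) / 2) / s) +
      Real.exp (-(β * (x - m) ^ 2 / (2 * s ^ 2))) * (1 / s - (x - m) ^ 2 / s ^ 3)))) s := by
  unfold psiDPD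
  have h := ((h_rp β s hs).mul_const ((2 * π) ^ (-β / 2))).mul
    (((hE_s β x m s hs).const_mul β⁻¹).const_sub ((1 + β) ^ (-(3 : ℝ) / 2)))
  refine HasDerivAt.congr_deriv h ?_
  generalize Real.exp _ = E
  generalize s ^ (-β) = S
  generalize (2 * π) ^ (-β / 2) = C
  generalize (1 + β) ^ (-(3 : ℝ) / 2) = A
  field_simp
  ring

lemma hess00 (β : ℝ) (hβ : 0 < β) (x m s : ℝ) (hs : 0 < s) :
    hessPsi β m s x 0 0 = (2 * π) ^ (-β / 2) * s ^ (-β) * (0 + 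
      (1 / s ^ 2 + - β / s ^ 4 * (x - m) ^ 2 + 0 * (x - m) ^ 4)
        * Real.exp (-(β * (x - m) ^ 2 / (2 * s ^ 2)))) := by
  simp only [hessPsi, Matrix.of_apply, Matrix.cons_val', Matrix.cons_val_zero]
  simp_rw [fun m => (psi_mu β hβ x m s).deriv]
  have h := (((((hasDerivAt_id m).const_sub x).div_const (s ^ 2)).mul (hE_mu β x m s)).const_mul
    (s ^ (-β) * (2 * π) ^ (-β / 2))).neg
  refine Eq.trans (HasDerivAt.deriv h) ?_
  simp only [id]
  field_simp
  ring

lemma hess01 (β : ℝ) (hβ : 0 < β) (x m s : ℝ) (hs : 0 < s) :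
    hessPsi β m s x 0 1 = (2 * π) ^ (-β / 2) * s ^ (-β) *
      (((β + 2) / s ^ 3 * (x - m) + - β / s ^ 5 * (x - m) ^ 3)
        * Real.exp (-(β * (x - m) ^ 2 / (2 * s ^ 2)))) := by
  have e : hessPsi β m s x 0 1 = deriv (fun m => deriv (fun s => psiDPD β x m s) s) m := rfl
  rw [e]
  simp_rw [fun m => (psi_s β hβ x m s hs).deriv]
  have h := ((((hE_mu β x m s).mul
    (((((hasDerivAt_id m).const_sub x).pow 2).div_const (s ^ 3)).const_sub (1 / s))).const_add
      (-(β * (1 + β) ^ (-(3 : ℝ) / 2) / s))).const_mul (s ^ (-β))).const_mul ((2 * π) ^ (-β / 2))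
  refine Eq.trans (HasDerivAt.deriv h) ?_
  simp
  field_simp
  ring

lemma hess10 (β : ℝ) (hβ : 0 < β) (x m s : ℝ) (hs : 0 < s) :
    hessPsi β m s x 1 0 = (2 * π) ^ (-β / 2) * s ^ (-β) *
      (((β + 2) / s ^ 3 * (x - m) + - β / s ^ 5 * (x - m) ^ 3)
        * Real.exp (-(β * (x - m) ^ 2 / (2 * s ^ 2)))) := by
  have e : hessPsi β m s x 1 0 = deriv (fun s => deriv (fun m => psiDPD β x m s) m) s := rfl
  rw [e]
  simp_rw [fun s => (psi_mu β hβ x m s).deriv]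
  have h := (((h_rp β s hs).mul_const ((2 * π) ^ (-β / 2))).mul
    (((hasDerivAt_const s (x - m)).div ((hasDerivAt_id s).pow 2) (by simp [hs.ne'])).mul
      (hE_s β x m s hs))).neg
  refine Eq.trans (HasDerivAt.deriv h) ?_
  simp
  field_simp
  ring

lemma hess11 (β : ℝ) (hβ : 0 < β) (x m s : ℝ) (hs : 0 < s) :
    hessPsi β m s x 1 1 = (2 * π) ^ (-β / 2) * s ^ (-β) *
      (β * (1 + β) * (1 + β) ^ (-(3 : ℝ) / 2) / s ^ 2 +
      (-(1 + β) / s ^ 2 + (2 * β + 3) / s ^ 4 * (x - m) ^ 2 + - β / s ^ 6 * (x - m) ^ 4)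
        * Real.exp (-(β * (x - m) ^ 2 / (2 * s ^ 2)))) := by
  have e : hessPsi β m s x 1 1 = deriv (fun s => deriv (fun s => psiDPD β x m s) s) s := rfl
  rw [e]
  have ev : (fun s => deriv (fun s => psiDPD β x m s) s) =ᶠ[nhds s] _ :=
    (eventually_gt_nhds hs).mono fun s hs => (psi_s β hβ x m s hs).deriv
  rw [ev.deriv_eq]
  have h := ((h_rp β s hs).mul
    (((hasDerivAt_const s (β * (1 + β) ^ (-(3 : ℝ) / 2))).div (hasDerivAt_id s) hs.ne').neg.add
      ((hE_s β x m s hs).mul (((hasDerivAt_const s (1:ℝ)).div (hasDerivAt_id s) hs.ne').sub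
        ((hasDerivAt_const s ((x - m) ^ 2)).div ((hasDerivAt_id s).pow 3)
          (by simp [hs.ne'])))))).const_mul ((2 * π) ^ (-β / 2))
  refine Eq.trans (HasDerivAt.deriv h) ?_
  simp
  field_simp
  ring

lemma int_pow (w : NNReal) (n : ℕ) : Integrable (fun x : ℝ => x ^ n) (gaussianReal 0 w) := by
  have := (memLp_id_gaussianReal (μ := 0) (v := w) n).integrable_norm_pow'
  refine this.mono' (by fun_prop) (ae_of_all _ fun x => by simp)

lemma mom2 (w : NNReal) : ∫ x, x ^ 2 ∂(gaussianReal 0 w) = w := by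
  have h := variance_fun_id_gaussianReal (μ := 0) (v := w)
  rw [variance_eq_integral (by fun_prop)] at h
  simpa using h

lemma mom4 (w : NNReal) : ∫ x, x ^ 4 ∂(gaussianReal 0 w) = 3 * (w : ℝ) ^ 2 := by
  have h := iteratedDeriv_mgf_zero (X := id) (μ := gaussianReal 0 w) (by simp) 4
  have h' : ∫ x, x ^ 4 ∂(gaussianReal 0 w) = (gaussianReal 0 w)[id ^ 4] := rfl
  rw [h', ← h, mgf_id_gaussianReal]
  have hf (t : ℝ) : HasDerivAt (fun t : ℝ => rexp (0 * t + w * t ^ 2 / 2))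
      (rexp (0 * t + w * t ^ 2 / 2) * (w * t)) t := by
    have := (((hasDerivAt_id t).const_mul (0:ℝ)).add
      ((((hasDerivAt_id t).pow 2).const_mul (w:ℝ)).div_const 2)).exp
    refine HasDerivAt.congr_deriv this ?_
    simp
    ring
  have d1 : deriv (fun t : ℝ => rexp (0 * t + w * t ^ 2 / 2)) = fun t => 
      rexp (0 * t + w * t ^ 2 / 2) * (w * t) := funext fun t => (hf t).deriv
  have d2 : deriv (fun t : ℝ => rexp (0 * t + w * t ^ 2 / 2) * (w * t)) = fun t => 
      rexp (0 * t + w * t ^ 2 / 2) * (w + w ^ 2 * t ^ 2) := funext fun t => by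
    refine Eq.trans ((hf t).mul ((hasDerivAt_id t).const_mul (w:ℝ))).deriv ?_
    simp
    ring
  have d3 : deriv (fun t : ℝ => rexp (0 * t + w * t ^ 2 / 2) * (w + w ^ 2 * t ^ 2)) = fun t => 
      rexp (0 * t + w * t ^ 2 / 2) * (3 * w ^ 2 * t + w ^ 3 * t ^ 3) := funext fun t => by
    refine Eq.trans ((hf t).mul ((((hasDerivAt_id t).pow 2).const_mul ((w:ℝ) ^ 2)).const_add
      (w:ℝ))).deriv ?_
    simp
    ring
  have d4 : deriv (fun t : ℝ => rexp (0 * t + w * t ^ 2 / 2) * (3 * w ^ 2 * t + w ^ 3 * t ^ 3)) 0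
      = 3 * (w : ℝ) ^ 2 := by
    refine Eq.trans ((hf 0).mul (((hasDerivAt_id (0:ℝ)).const_mul (3 * (w:ℝ) ^ 2)).add
      (((hasDerivAt_id (0:ℝ)).pow 3).const_mul ((w:ℝ) ^ 3)))).deriv ?_
    simp
  rw [iteratedDeriv_succ', iteratedDeriv_succ', iteratedDeriv_succ', iteratedDeriv_succ',
    iteratedDeriv_zero]
  rw [d1, d2, d3, d4]

lemma int_shift (m : ℝ) (v : NNReal) (g : ℝ → ℝ) :
    ∫ x, g (x - m) ∂(gaussianReal m v) = ∫ x, g x ∂(gaussianReal 0 v) := by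
  have h := gaussianReal_map_sub_const (μ := m) (v := v) m
  rw [sub_self] at h
  rw [← h]
  exact ((MeasurableEquiv.subRight m).measurableEmbedding.integral_map g).symm

lemma int_tilt (β s : ℝ) (hβ : 0 < β) (hs : 0 < s) (g : ℝ → ℝ) :
    ∫ x, g x * Real.exp (-(β * x ^ 2 / (2 * s ^ 2))) ∂(gaussianReal 0 (Real.toNNReal (s ^ 2)))
    = (√(1 + β))⁻¹ * ∫ x, g x ∂(gaussianReal 0 (Real.toNNReal (s ^ 2 / (1 + β)))) := by
  have h1 : Real.toNNReal (s ^ 2) ≠ 0 := by simp; positivity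
  have h2 : Real.toNNReal (s ^ 2 / (1 + β)) ≠ 0 := by simp; positivity
  rw [integral_gaussianReal_eq_integral_smul h1, integral_gaussianReal_eq_integral_smul h2,
    ← integral_const_mul]
  congr 1
  ext x
  simp only [gaussianPDFReal, smul_eq_mul]
  rw [Real.coe_toNNReal _ (by positivity), Real.coe_toNNReal _ (by positivity)]
  have e : rexp (-(x - 0) ^ 2 / (2 * (s ^ 2 / (1 + β)))) = rexp (-(x - 0) ^ 2 / (2 * s ^ 2)) *
      Real.exp (-(β * x ^ 2 / (2 * s ^ 2))) := by
    rw [← Real.exp_add]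
    congr 1
    field_simp
    ring
  have e2 : √(2 * π * (s ^ 2 / (1 + β))) = √(2 * π * s ^ 2) / √(1 + β) := by
    rw [← Real.sqrt_div (by positivity)]
    congr 1
    ring
  rw [e, e2]
  have : 0 < √(1 + β) := Real.sqrt_pos.2 (by positivity)
  have : 0 < √(2 * π * s ^ 2) := Real.sqrt_pos.2 (by positivity)
  field_simp

lemma int_main (β m s : ℝ) (hβ : 0 < β) (hs : 0 < s) (D K a b c : ℝ) :
    ∫ x, D * (K + (a + b * (x - m) ^ 2 + c * (x - m) ^ 4) *
      Real.exp (-(β * (x - m) ^ 2 / (2 * s ^ 2)))) ∂(gaussianReal m (Real.toNNReal (s ^ 2)))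
    = D * (K + (√(1 + β))⁻¹ * (a + b * (s ^ 2 / (1 + β)) + c * (3 * (s ^ 2 / (1 + β)) ^ 2))) := by
  rw [int_shift m _ (fun x => D * (K + (a + b * x ^ 2 + c * x ^ 4) *
      Real.exp (-(β * x ^ 2 / (2 * s ^ 2))))), integral_const_mul]
  have hp (w : NNReal) :
      Integrable (fun x : ℝ => a + b * x ^ 2 + c * x ^ 4) (gaussianReal 0 w) :=
    ((integrable_const a).add ((int_pow w 2).const_mul b)).add ((int_pow w 4).const_mul c)
  rw [integral_add (integrable_const K), int_tilt β s hβ hs]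
  · rw [integral_add, integral_add, integral_const_mul, integral_const_mul, mom2, mom4,
      Real.coe_toNNReal _ (by positivity)]
    · simp
    · exact integrable_const _
    · exact (int_pow _ 2).const_mul b
    · exact (integrable_const a).add ((int_pow _ 2).const_mul b)
    · exact (int_pow _ 4).const_mul c
  · refine (hp _).mono (by fun_prop) (ae_of_all _ fun x => ?_)
    rw [norm_mul]
    refine mul_le_of_le_one_right (norm_nonneg _) ?_
    rw [Real.norm_eq_abs, Real.abs_exp, Real.exp_le_one_iff, neg_nonpos]
    positivity

lemma int_odd (m : ℝ) (v : NNReal) (g : ℝ → ℝ) (hg : ∀ x, g (-x) = - g x) :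
    ∫ x, g (x - m) ∂(gaussianReal m v) = 0 := by
  rw [int_shift]
  have h := gaussianReal_map_neg (μ := 0) (v := v)
  rw [neg_zero] at h
  have h2 : ∫ x, g x ∂(gaussianReal 0 v) = ∫ x, g (-x) ∂(gaussianReal 0 v) := by
    conv_lhs => rw [← h]
    exact (MeasurableEquiv.neg ℝ).measurableEmbedding.integral_map g
  simp_rw [hg, integral_neg] at h2
  linarith

lemma int_mixed (β m s : ℝ) (v : NNReal) (D a b : ℝ) :
    ∫ x, D * ((a * (x - m) + b * (x - m) ^ 3) *
      Real.exp (-(β * (x - m) ^ 2 / (2 * s ^ 2)))) ∂(gaussianReal m v) = 0 :=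
  int_odd m v (fun x => D * ((a * x + b * x ^ 3) *
      Real.exp (-(β * x ^ 2 / (2 * s ^ 2))))) fun x => by
    simp only [even_two.neg_pow]; ring

/-- **Expected Hessian of the DPD objective under the model.** If `X ~ N(μ₀, σ₀²)` then
`E[∇²ψ_β(X; μ₀, σ₀)] = J_β(σ₀)`, a diagonal matrix; in particular the expected mixed partial
derivatives vanish. -/
theorem dpd_expected_hessian
    (β : ℝ) (hβ : 0 < β) (μ₀ σ₀ : ℝ) (hσ₀ : 0 < σ₀) :
    (Matrix.of fun i j : Fin 2 =>
        ∫ x, hessPsi β μ₀ σ₀ x i j ∂(gaussianReal μ₀ (Real.toNNReal (σ₀ ^ 2)))) =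
      (Real.sqrt (1 + β) * (2 * π) ^ (β / 2) * σ₀ ^ (2 + β))⁻¹ •
        Matrix.diagonal ![1 / (1 + β), (β ^ 2 + 2) / (1 + β) ^ 2] := by
  have hc : (Real.sqrt (1 + β) * (2 * π) ^ (β / 2) * σ₀ ^ (2 + β))⁻¹ =
      (2 * π) ^ (-β / 2) * σ₀ ^ (-β) * ((√(1 + β))⁻¹ / σ₀ ^ 2) := by
    rw [neg_div, Real.rpow_neg (by positivity), Real.rpow_neg hσ₀.le, Real.rpow_add hσ₀,
      Real.rpow_two]
    field_simp
  have hA : (1 + β) ^ (-(3 : ℝ) / 2) = (√(1 + β))⁻¹ / (1 + β) := by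
    rw [show -(3 : ℝ) / 2 = -(1 / 2) - 1 by norm_num, Real.rpow_sub_one (by positivity),
      Real.rpow_neg (by positivity), Real.sqrt_eq_rpow]
  have h1 : 0 < 1 + β := by positivity
  have hq : 0 < √(1 + β) := Real.sqrt_pos.2 h1
  rw [hc]
  ext i j
  rw [Matrix.of_apply, Matrix.smul_apply]
  fin_cases i <;> fin_cases j <;>
    simp only [Fin.zero_eta, Fin.mk_one, Fin.isValue, smul_eq_mul]
  · simp_rw [hess00 β hβ _ μ₀ σ₀ hσ₀]
    rw [int_main β μ₀ σ₀ hβ hσ₀]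
    simp only [Matrix.diagonal_apply_eq, Matrix.cons_val_zero]
    field_simp
    ring
  · simp_rw [hess01 β hβ _ μ₀ σ₀ hσ₀]
    rw [int_mixed]
    simp
  · simp_rw [hess10 β hβ _ μ₀ σ₀ hσ₀]
    rw [int_mixed]
    simp
  · simp_rw [hess11 β hβ _ μ₀ σ₀ hσ₀]
    rw [int_main β μ₀ σ₀ hβ hσ₀, hA]
    simp only [Matrix.diagonal_apply_eq, Matrix.cons_val_one, Matrix.cons_val_zero]
    field_simp
    ring

end
end
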